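/- Let m = 3 and n be arbitrary, and let Φ be a 3×n channel matrix of rank 3. Suppose the capacity-achieving input distribution λ* = (λ*_1, λ*_2, λ*_3) satisfies λ*_1 > 0, λ*_2 > 0, λ*_3 = 0 and D(P^3‖Q*) = C, where Q* = λ*Φ with Q*_j > 0 for all j. Define D*_{i',i} = −Σ_j P^{i'}_j P^i_j / Q*_j, b_1 = λ*_1 (D*_{1,2} − D*_{1,3}) / (1 + D*_{1,2}), b_2 = λ*_2 (D*_{1,2} − D*_{2,3}) / (1 + D*_{1,2}), and ρ = λ*_1 D*_{1,3}(D*_{1,2} − D*_{1,3})/(1 + D*_{1,2}) + λ*_2 D*_{2,3}(D*_{1,2} − D*_{2,3})/(1 + D*_{1,2}) − D*_{3,3}, and assume ρ > 0. Then for the Arimoto sequence λ^{N+1} = F(λ^N) with initial distribution λ⁰ ∈ Δ(X)° sufficiently close to λ*, writing μ^N = λ^N − λ* = (μ^N_1, μ^N_2, μ^N_3), the convergence μ^N → 0 is of order 1/N and lim_{N→∞} N μ^N_1 = −b_1/ρ, lim_{N→∞} N μ^N_2 = −b_2/ρ, lim_{N→∞} N μ^N_3 = 1/ρ. (Theorem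 7) -/

import Mathlib

open scoped BigOperators

noncomputable section

/-- The simplex of probability vectors on `Fin m`. -/
def chSimplex (m : ℕ) : Set (Fin m → ℝ) :=
  {l | (∀ i, 0 ≤ l i) ∧ ∑ i, l i = 1}

/-- The output distribution `λΦ` of the channel `P` for input distribution `l`. -/
def chOut {m n : ℕ} (P : Matrix (Fin m) (Fin n) ℝ) (l : Fin m → ℝ) (j : Fin n) : ℝ :=
  ∑ i, l i * P i j

/-- Kullback-Leibler divergence `D(Q‖Q')`. -/
def chKL {n : ℕ} (Q Q' : Fin n → ℝ) : ℝ :=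
  ∑ j, Q j * Real.log (Q j / Q' j)

/-- Mutual information `I(λ,Φ)`. -/
def chMI {m n : ℕ} (P : Matrix (Fin m) (Fin n) ℝ) (l : Fin m → ℝ) : ℝ :=
  ∑ i, ∑ j, l i * P i j * Real.log (P i j / chOut P l j)

/-- The Arimoto map `F(λ)`, componentwise. -/
def chAF {m n : ℕ} (P : Matrix (Fin m) (Fin n) ℝ) (l : Fin m → ℝ) (i : Fin m) : ℝ :=
  l i * Real.exp (chKL (P i) (chOut P l)) /
    ∑ k, l k * Real.exp (chKL (P k) (chOut P l))

/-- Partial derivative `∂f/∂λ_{i'}` at `x`, treating the coordinates as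
independent variables. -/
def chPd {m : ℕ} (f : (Fin m → ℝ) → ℝ) (i' : Fin m) (x : Fin m → ℝ) : ℝ :=
  fderiv ℝ f x (Pi.single i' 1)

/-- Second partial derivative `∂²f/∂λ_{i'}∂λ_{i''}` at `x`. -/
def chPd2 {m : ℕ} (f : (Fin m → ℝ) → ℝ) (i' i'' : Fin m) (x : Fin m → ℝ) : ℝ :=
  chPd (chPd f i'') i' x

section

open Filter Topology

/-- A nonnegative sequence contracting up to a vanishing error tends to zero. -/
lemma tendsto_zero_of_contract {v e : ℕ → ℝ} {a : ℝ} (ha0 : 0 ≤ a) (ha1 : a < 1)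
    (hv : ∀ N, 0 ≤ v N) (he : Tendsto e atTop (𝓝 0))
    (hstep : ∀ᶠ N in atTop, v (N + 1) ≤ a * v N + e N) :
    Tendsto v atTop (𝓝 0) := by
  refine tendsto_order.2 ⟨fun b hb => Eventually.of_forall fun N => hb.trans_le (hv N), ?_⟩
  intro η hη
  have hc : 0 < (1 - a) * (η / 2) := by
    have : 0 < 1 - a := by linarith
    positivity
  obtain ⟨N₀, hN₀⟩ := eventually_atTop.1 (hstep.and (he.eventually (gt_mem_nhds hc)))
  have hpow : ∀ k, v (N₀ + k) - η / 2 ≤ a ^ k * v N₀ := by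
    intro k
    induction k with
    | zero => simp; linarith
    | succ k ih =>
      obtain ⟨h1, h2⟩ := hN₀ (N₀ + k) (by omega)
      have h3 := mul_le_mul_of_nonneg_left ih ha0
      rw [← add_assoc, pow_succ']
      nlinarith
  have hlim : Tendsto (fun k => a ^ k * v N₀) atTop (𝓝 0) := by
    simpa using (tendsto_pow_atTop_nhds_zero_of_lt_one ha0 ha1).mul_const (v N₀)
  obtain ⟨K, hK⟩ := eventually_atTop.1 (hlim.eventually (gt_mem_nhds (half_pos hη)))
  refine eventually_atTop.2 ⟨N₀ + K, fun N hN => ?_⟩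
  obtain ⟨k, rfl⟩ := Nat.exists_eq_add_of_le (show N₀ ≤ N by omega)
  have h1 := hpow k
  have h2 := hK k (by omega)
  linarith

/-- First-order error bound at the origin of the plane, in terms of `|u| + z`. -/
lemma exists_linear_approx {f : ℝ × ℝ → ℝ} {f' : ℝ × ℝ →L[ℝ] ℝ} (hf : HasFDerivAt f f' 0)
    {ε : ℝ} (hε : 0 < ε) :
    ∃ r > 0, ∀ u z : ℝ, |u| < r → 0 < z → z < r →
      |f (u, z) - f 0 - f' (u, z)| ≤ ε * (|u| + z) := by
  obtain ⟨r, hr, h⟩ := Metric.eventually_nhds_iff.1 ((hasFDerivAt_iff_isLittleO.1 hf).def hε)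
  refine ⟨r, hr, fun u z hu hz hzr => ?_⟩
  have hn : ‖((u, z) : ℝ × ℝ)‖ < r := by
    rw [Prod.norm_def]
    simpa [abs_of_pos hz] using ⟨hu, hzr⟩
  have h1 := @h (u, z) (by simpa using hn)
  rw [sub_zero] at h1
  refine h1.trans (mul_le_mul_of_nonneg_left ?_ hε.le)
  rw [Prod.norm_def]
  simp only [Real.norm_eq_abs, abs_of_pos hz]
  exact max_le (by linarith) (by linarith [abs_nonneg u])

/-- The error of the first-order approximation, relative to `|u| + z`, vanishes along
sequences converging to the origin. -/
lemma exists_vanishing_error {f : ℝ × ℝ → ℝ} {f' : ℝ × ℝ →L[ℝ] ℝ} (hf : HasFDerivAt f f' 0)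
    {u z : ℕ → ℝ} (hz : ∀ N, 0 < z N) (hu0 : Tendsto u atTop (𝓝 0))
    (hz0 : Tendsto z atTop (𝓝 0)) :
    ∃ e : ℕ → ℝ, Tendsto e atTop (𝓝 0) ∧
      ∀ N, f (u N, z N) = f 0 + f' (u N, z N) + e N * (|u N| + z N) := by
  have hpos : ∀ N, 0 < |u N| + z N := fun N => by linarith [abs_nonneg (u N), hz N]
  refine ⟨fun N => (f (u N, z N) - f 0 - f' (u N, z N)) / (|u N| + z N), ?_, fun N => ?_⟩
  · rw [Metric.tendsto_atTop]
    intro ε hε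
    obtain ⟨r, hr, h⟩ := exists_linear_approx hf (half_pos hε)
    have h1 : ∀ᶠ N in atTop, |u N| < r := by
      have := hu0.abs
      rw [abs_zero] at this
      exact this.eventually (gt_mem_nhds hr)
    obtain ⟨N₀, hN₀⟩ := eventually_atTop.1 (h1.and (hz0.eventually (gt_mem_nhds hr)))
    refine ⟨N₀, fun N hN => ?_⟩
    have h2 := h (u N) (z N) (hN₀ N hN).1 (hz N) (hN₀ N hN).2
    rw [Real.dist_eq, sub_zero, abs_div, abs_of_pos (hpos N)]
    exact (div_le_of_le_mul₀ (hpos N).le (half_pos hε).le h2).trans_lt (half_lt_self hε)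
  · rw [div_mul_cancel₀ _ (hpos N).ne']
    ring

/-- Local attraction to a semi-hyperbolic fixed point: the orbit of a planar map with one
contracting direction and one neutral, quadratically attracting direction converges. -/
lemma tendsto_zero_of_semihyperbolic {f g : ℝ × ℝ → ℝ} {a ρ κ : ℝ}
    (ha0 : 0 ≤ a) (ha1 : a < 1) (hρ : 0 < ρ)
    (hf0 : f 0 = 0) (hg0 : g 0 = 1)
    (hf : HasFDerivAt f (a • ContinuousLinearMap.fst ℝ ℝ ℝ) 0)
    (hg : HasFDerivAt g (κ • ContinuousLinearMap.fst ℝ ℝ ℝ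
      - ρ • ContinuousLinearMap.snd ℝ ℝ ℝ) 0) :
    ∃ δ > 0, ∀ u z : ℕ → ℝ, (∀ N, 0 < z N) → |u 0| < δ → z 0 < δ →
      (∀ N, u (N + 1) = f (u N, z N)) → (∀ N, z (N + 1) = z N * g (u N, z N)) →
      Tendsto u atTop (𝓝 0) ∧ Tendsto z atTop (𝓝 0) := by
  set b : ℝ := (1 + a) / 2 with hb
  have hb0 : 0 ≤ b := by positivity
  have hb1 : 0 < 1 - b := by rw [hb]; linarith
  set M : ℝ := (|κ| + 1) / (1 - b) with hM
  have hM0 : 0 < M := by positivity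
  have hMb : |κ| + 1 + M * b = M := by rw [hM]; field_simp; ring
  set ε : ℝ := min (min (1 - b) 1) (ρ / (2 * (1 + M))) with hε
  have hε0 : 0 < ε := by positivity
  have hεb : ε ≤ 1 - b := (min_le_left _ _).trans (min_le_left _ _)
  have hε1 : ε ≤ 1 := (min_le_left _ _).trans (min_le_right _ _)
  have hερ : (1 + M) * ε ≤ ρ / 2 := by
    calc (1 + M) * ε ≤ (1 + M) * (ρ / (2 * (1 + M))) := by gcongr; exact min_le_right _ _
      _ = ρ / 2 := by field_simp
  obtain ⟨r₁, hr₁, hF⟩ := exists_linear_approx hf hε0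
  obtain ⟨r₂, hr₂, hG⟩ := exists_linear_approx hg hε0
  set r := min r₁ r₂ with hr
  have hr0 : 0 < r := lt_min hr₁ hr₂
  refine ⟨r * Real.exp (-(M * r)), by positivity, fun u z hz hu0 hz0 hu hzs => ?_⟩
  have hW : ∀ N, z N ≤ z N * Real.exp (M * |u N|) := fun N =>
    le_mul_of_one_le_right (hz N).le (Real.one_le_exp (by positivity))
  have hustep : ∀ N, |u N| < r → z N * Real.exp (M * |u N|) < r →
      |u (N + 1)| ≤ b * |u N| + ε * z N := by
    intro N h1 h2
    have h3 := hF (u N) (z N) (h1.trans_le (min_le_left _ _)) (hz N)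
      (((hW N).trans_lt h2).trans_le (min_le_left _ _))
    simp [hf0, ← hu] at h3
    have h4 : |u (N + 1)| ≤ |u (N + 1) - a * u N| + a * |u N| := by
      calc |u (N + 1)| = |(u (N + 1) - a * u N) + a * u N| := by ring_nf
        _ ≤ _ := (abs_add_le _ _).trans (by rw [abs_mul, abs_of_nonneg ha0])
    nlinarith [abs_nonneg (u N)]
  have hWstep : ∀ N, |u N| < r → z N * Real.exp (M * |u N|) < r →
      z (N + 1) * Real.exp (M * |u (N + 1)|) * Real.exp (ρ / 2 * z N)
        ≤ z N * Real.exp (M * |u N|) := by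
    intro N h1 h2
    have h3 := hG (u N) (z N) (h1.trans_le (min_le_right _ _)) (hz N)
      (((hW N).trans_lt h2).trans_le (min_le_right _ _))
    simp [hg0] at h3
    have h4 : g (u N, z N) ≤ Real.exp (-ρ * z N + ε * z N + (|κ| + 1) * |u N|) := by
      refine le_trans ?_ (Real.add_one_le_exp _)
      have h5 := (abs_le.1 h3).2
      have h6 : κ * u N ≤ |κ| * |u N| := by rw [← abs_mul]; exact le_abs_self _
      nlinarith [abs_nonneg (u N)]
    rw [hzs N]
    calc z N * g (u N, z N) * Real.exp (M * |u (N + 1)|) * Real.exp (ρ / 2 * z N)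
        ≤ z N * Real.exp (-ρ * z N + ε * z N + (|κ| + 1) * |u N|)
            * Real.exp (M * (b * |u N| + ε * z N)) * Real.exp (ρ / 2 * z N) := by
          have := (hz N).le
          gcongr
          exact hustep N h1 h2
      _ = z N * Real.exp ((-ρ * z N + ε * z N + (|κ| + 1) * |u N|)
            + M * (b * |u N| + ε * z N) + ρ / 2 * z N) := by
          rw [mul_assoc, mul_assoc, ← Real.exp_add, ← Real.exp_add]
          congr 2
          ring
      _ ≤ z N * Real.exp (M * |u N|) := by
          have h7 := mul_le_mul_of_nonneg_right hερ (hz N).le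
          have h8 : (|κ| + 1 + M * b) * |u N| = M * |u N| := by rw [hMb]
          have := (hz N).le
          gcongr
          nlinarith
  have hinv : ∀ N, |u N| < r ∧ z N * Real.exp (M * |u N|) < r := by
    intro N
    induction N with
    | zero =>
      have h1 : |u 0| < r := hu0.trans_le
        (mul_le_of_le_one_right hr0.le (Real.exp_le_one_iff.2 (by nlinarith)))
      refine ⟨h1, ?_⟩
      calc z 0 * Real.exp (M * |u 0|) ≤ z 0 * Real.exp (M * r) := by
            have := (hz 0).le
            gcongr
        _ < r * Real.exp (-(M * r)) * Real.exp (M * r) := by gcongr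
        _ = r := by rw [mul_assoc, ← Real.exp_add]; simp
    | succ N ih =>
      obtain ⟨h1, h2⟩ := ih
      constructor
      · have h3 := hustep N h1 h2
        have h4 := (hW N).trans_lt h2
        have h5 : ε * z N ≤ (1 - b) * z N := by
          have := (hz N).le
          gcongr
        nlinarith
      · refine lt_of_le_of_lt ?_ h2
        refine le_trans ?_ (hWstep N h1 h2)
        have := (hz N).le
        have := (hz (N + 1)).le
        exact le_mul_of_one_le_right (by positivity) (Real.one_le_exp (by positivity))
  set c : ℝ := ρ / 2 * Real.exp (-(M * r)) with hc
  have hc0 : 0 < c := by positivity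
  have hWinv : ∀ N : ℕ, c * N ≤ (z N * Real.exp (M * |u N|))⁻¹ := by
    intro N
    induction N with
    | zero => have := (hz 0).le; simp; positivity
    | succ N ih =>
      obtain ⟨h1, h2⟩ := hinv N
      have hzN := hz N
      have hzN1 := hz (N + 1)
      have hw : 0 < z N * Real.exp (M * |u N|) := by positivity
      have hw1 : 0 < z (N + 1) * Real.exp (M * |u (N + 1)|) := by positivity
      have h3 := hWstep N h1 h2
      have h4 : 1 + c * (z N * Real.exp (M * |u N|)) ≤ Real.exp (ρ / 2 * z N) := by
        have h5 : c * (z N * Real.exp (M * |u N|)) ≤ ρ / 2 * z N := by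
          calc c * (z N * Real.exp (M * |u N|))
              = ρ / 2 * z N * Real.exp (-(M * r) + M * |u N|) := by
                rw [Real.exp_add, hc]; ring
            _ ≤ ρ / 2 * z N * 1 := by
                gcongr
                exact Real.exp_le_one_iff.2 (by nlinarith)
            _ = _ := mul_one _
        linarith [Real.add_one_le_exp (ρ / 2 * z N)]
      have h6 := (mul_le_mul_of_nonneg_left h4 hw1.le).trans h3
      generalize z N * Real.exp (M * |u N|) = w at *
      generalize z (N + 1) * Real.exp (M * |u (N + 1)|) = w' at *
      have h7 : w⁻¹ + c ≤ w'⁻¹ := by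
        rw [inv_eq_one_div, inv_eq_one_div, div_add' _ _ _ hw.ne', div_le_div_iff₀ hw hw1]
        nlinarith
      push_cast
      linarith
  have hz0 : Tendsto z atTop (𝓝 0) := by
    have h1 : Tendsto (fun N : ℕ => (z N * Real.exp (M * |u N|))⁻¹) atTop atTop :=
      tendsto_atTop_mono hWinv (tendsto_natCast_atTop_atTop.const_mul_atTop hc0)
    have h2 := h1.inv_tendsto_atTop
    simp only [Pi.inv_def, inv_inv] at h2
    exact squeeze_zero (fun N => (hz N).le) hW h2
  refine ⟨?_, hz0⟩
  have h1 : Tendsto (fun N => |u N|) atTop (𝓝 0) :=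
    tendsto_zero_of_contract hb0 (by linarith) (fun N => abs_nonneg _)
      (by simpa using hz0.const_mul ε)
      (Eventually.of_forall fun N => hustep N (hinv N).1 (hinv N).2)
  exact tendsto_zero_iff_abs_tendsto_zero _ |>.2 h1

/-- The rate of convergence of orbits tending to a semi-hyperbolic fixed point. -/
lemma tendsto_rate_of_semihyperbolic {f g : ℝ × ℝ → ℝ} {a ρ κ : ℝ}
    (ha0 : 0 ≤ a) (ha1 : a < 1) (hρ : 0 < ρ)
    (hf0 : f 0 = 0) (hg0 : g 0 = 1)
    (hf : HasFDerivAt f (a • ContinuousLinearMap.fst ℝ ℝ ℝ) 0)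
    (hg : HasFDerivAt g (κ • ContinuousLinearMap.fst ℝ ℝ ℝ
      - ρ • ContinuousLinearMap.snd ℝ ℝ ℝ) 0)
    {u z : ℕ → ℝ} (hz : ∀ N, 0 < z N)
    (hu : ∀ N, u (N + 1) = f (u N, z N)) (hzs : ∀ N, z (N + 1) = z N * g (u N, z N))
    (hu0 : Tendsto u atTop (𝓝 0)) (hz0 : Tendsto z atTop (𝓝 0)) :
    Tendsto (fun N : ℕ => (N : ℝ) * u N) atTop (𝓝 0) ∧
      Tendsto (fun N : ℕ => (N : ℝ) * z N) atTop (𝓝 (1 / ρ)) := by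
  obtain ⟨e, he, hfe⟩ := exists_vanishing_error hf hz hu0 hz0
  obtain ⟨e', he', hge⟩ := exists_vanishing_error hg hz hu0 hz0
  simp [hf0] at hfe
  simp [hg0] at hge
  have hgpos : ∀ N, 0 < g (u N, z N) := fun N => by
    have := hz (N + 1)
    rw [hzs N] at this
    exact pos_of_mul_pos_right this (hz N).le
  have hg1 : Tendsto (fun N => g (u N, z N)) atTop (𝓝 1) := by
    have h := hg.continuousAt.tendsto.comp (hu0.prodMk_nhds hz0)
    rwa [hg0] at h
  have he_abs : Tendsto (fun N => |e N|) atTop (𝓝 0) := by simpa using he.abs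
  have hw : Tendsto (fun N => |u N| / z N) atTop (𝓝 0) := by
    have hcoef : Tendsto (fun N => (a + |e N|) / g (u N, z N)) atTop (𝓝 a) := by
      simpa [Pi.div_def] using (he_abs.const_add a).div hg1 one_ne_zero
    have herr : Tendsto (fun N => |e N| / g (u N, z N)) atTop (𝓝 0) := by
      simpa [Pi.div_def] using he_abs.div hg1 one_ne_zero
    refine tendsto_zero_of_contract (a := (a + 1) / 2) (by linarith) (by linarith)
      (fun N => div_nonneg (abs_nonneg _) (hz N).le) herr ?_
    filter_upwards [hcoef.eventually (gt_mem_nhds (show a < (a + 1) / 2 by linarith))] with N hN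
    have hzN := hz N
    have hgN := hgpos N
    have h1 : |u (N + 1)| ≤ a * |u N| + |e N| * (|u N| + z N) := by
      rw [hu N, hfe N]
      refine (abs_add_le _ _).trans ?_
      rw [abs_mul, abs_mul, abs_of_nonneg ha0,
        abs_of_pos (show 0 < |u N| + z N by positivity)]
    calc |u (N + 1)| / z (N + 1)
        ≤ (a * |u N| + |e N| * (|u N| + z N)) / (z N * g (u N, z N)) := by
          rw [hzs N]; gcongr
      _ = (a + |e N|) / g (u N, z N) * (|u N| / z N) + |e N| / g (u N, z N) := by
          field_simp; ring
      _ ≤ (a + 1) / 2 * (|u N| / z N) + |e N| / g (u N, z N) := by gcongr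
  have hw' : Tendsto (fun N => u N / z N) atTop (𝓝 0) := by
    rw [tendsto_zero_iff_abs_tendsto_zero]
    refine hw.congr fun N => ?_
    simp [abs_div, abs_of_pos (hz N)]
  have hdiff : Tendsto (fun N => (z (N + 1))⁻¹ - (z N)⁻¹) atTop (𝓝 ρ) := by
    have h1 : Tendsto (fun N => (ρ - κ * (u N / z N) - e' N * (|u N| / z N + 1))
        / g (u N, z N)) atTop (𝓝 ρ) := by
      simpa [Pi.div_def] using (((hw'.const_mul κ).const_sub ρ).sub
        (he'.mul (hw.add_const 1))).div hg1 one_ne_zero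
    refine h1.congr fun N => ?_
    have hzN := (hz N).ne'
    have hgN := (hgpos N).ne'
    rw [hzs N]
    have h2 := hge N
    generalize g (u N, z N) = G at *
    field_simp
    rw [h2]
    ring
  have hinv : Tendsto (fun N : ℕ => (N : ℝ)⁻¹ * (z N)⁻¹) atTop (𝓝 ρ) := by
    have h1 := hdiff.cesaro
    have h2 : Tendsto (fun N : ℕ => (N : ℝ)⁻¹ * (z 0)⁻¹) atTop (𝓝 0) := by
      simpa using (tendsto_inv_atTop_nhds_zero_nat (𝕜 := ℝ)).mul_const (z 0)⁻¹
    have h3 := h1.add h2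
    rw [add_zero] at h3
    refine h3.congr fun N => ?_
    rw [Finset.sum_range_sub (fun N => (z N)⁻¹)]
    ring
  have hNz : Tendsto (fun N : ℕ => (N : ℝ) * z N) atTop (𝓝 (1 / ρ)) := by
    rw [one_div]
    refine (hinv.inv₀ hρ.ne').congr fun N => ?_
    rw [mul_inv, inv_inv, inv_inv]
  refine ⟨?_, hNz⟩
  have h1 := hNz.mul hw'
  rw [mul_zero] at h1
  refine h1.congr fun N => ?_
  have := (hz N).ne'
  field_simp

/-- Derivative of `p ↦ D(R ‖ Q + p₁ A + p₂ B)` at the origin. -/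
lemma hasFDerivAt_chKL_affine {n : ℕ} (R Q A B : Fin n → ℝ) (hQ : ∀ j, 0 < Q j) :
    HasFDerivAt (fun p : ℝ × ℝ => chKL R (fun j => Q j + p.1 * A j + p.2 * B j))
      ((-∑ j, R j * A j / Q j) • ContinuousLinearMap.fst ℝ ℝ ℝ
        + (-∑ j, R j * B j / Q j) • ContinuousLinearMap.snd ℝ ℝ ℝ) 0 := by
  have hterm : ∀ j, HasFDerivAt
      (fun p : ℝ × ℝ => R j * Real.log (R j / (Q j + p.1 * A j + p.2 * B j)))
      ((-(R j * A j / Q j)) • ContinuousLinearMap.fst ℝ ℝ ℝ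
        + (-(R j * B j / Q j)) • ContinuousLinearMap.snd ℝ ℝ ℝ) 0 := by
    intro j
    by_cases hR : R j = 0
    · simpa [hR] using hasFDerivAt_const (0 : ℝ) (0 : ℝ × ℝ)
    have hq : HasFDerivAt (fun p : ℝ × ℝ => Q j + p.1 * A j + p.2 * B j)
        (A j • ContinuousLinearMap.fst ℝ ℝ ℝ + B j • ContinuousLinearMap.snd ℝ ℝ ℝ) 0 :=
      ((hasFDerivAt_fst.mul_const (A j)).const_add (Q j)).add (hasFDerivAt_snd.mul_const (B j))
    have hq0 : Q j + (0 : ℝ × ℝ).1 * A j + (0 : ℝ × ℝ).2 * B j ≠ 0 := by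
      simpa using (hQ j).ne'
    have hlog := ((hq.log hq0).const_sub (Real.log (R j))).const_mul (R j)
    have hev : (fun p : ℝ × ℝ => R j * Real.log (R j / (Q j + p.1 * A j + p.2 * B j)))
        =ᶠ[𝓝 0] fun p => R j * (Real.log (R j) - Real.log (Q j + p.1 * A j + p.2 * B j)) := by
      filter_upwards [hq.continuousAt.eventually_ne hq0] with p hp
      rw [Real.log_div hR hp]
    refine (hlog.congr_of_eventuallyEq hev).congr_fderiv ?_
    ext <;> simp <;> ring
  have hsum := HasFDerivAt.fun_sum (u := Finset.univ) fun j _ => hterm j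
  refine hsum.congr_fderiv ?_
  ext <;> simp

lemma chMI_eq_sum_chKL {m n : ℕ} (P : Matrix (Fin m) (Fin n) ℝ) (l : Fin m → ℝ) :
    chMI P l = ∑ i, l i * chKL (P i) (chOut P l) := by
  simp only [chMI, chKL, Finset.mul_sum, mul_assoc]

lemma sum_mul_exp_pos {m n : ℕ} [NeZero m] (P : Matrix (Fin m) (Fin n) ℝ) {l : Fin m → ℝ}
    (hl : ∀ i, 0 < l i) : 0 < ∑ k, l k * Real.exp (chKL (P k) (chOut P l)) :=
  Finset.sum_pos (fun k _ => mul_pos (hl k) (Real.exp_pos _)) Finset.univ_nonempty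

lemma chAF_pos {m n : ℕ} [NeZero m] (P : Matrix (Fin m) (Fin n) ℝ) {l : Fin m → ℝ}
    (hl : ∀ i, 0 < l i) (i : Fin m) : 0 < chAF P l i :=
  div_pos (mul_pos (hl i) (Real.exp_pos _)) (sum_mul_exp_pos P hl)

lemma sum_chAF {m n : ℕ} [NeZero m] (P : Matrix (Fin m) (Fin n) ℝ) {l : Fin m → ℝ}
    (hl : ∀ i, 0 < l i) : ∑ i, chAF P l i = 1 := by
  simp only [chAF]
  rw [← Finset.sum_div, div_self (sum_mul_exp_pos P hl).ne']

lemma Matrix.row_injective_of_rank_eq {m n : ℕ} (P : Matrix (Fin m) (Fin n) ℝ)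
    (h : P.rank = m) : Function.Injective P := by
  have : LinearIndependent ℝ P.row := by
    rw [linearIndependent_iff_card_eq_finrank_span, Set.finrank,
      ← Matrix.rank_eq_finrank_span_row, h, Fintype.card_fin]
  exact this.injective

/-- The point of the plane `∑ λ = 1` with coordinates `p` in the frame at `l` adapted to the
contracting direction `(1, -1, 0)` and the neutral direction `(-b, b - 1, 1)`. -/
def chPlane (l : Fin 3 → ℝ) (b : ℝ) (p : ℝ × ℝ) : Fin 3 → ℝ :=
  ![l 0 + p.1 - b * p.2, l 1 - p.1 + (b - 1) * p.2, l 2 + p.2]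

lemma chPlane_zero (l : Fin 3 → ℝ) (b : ℝ) : chPlane l b 0 = l := by
  ext i; fin_cases i <;> simp [chPlane]

lemma chOut_chPlane {n : ℕ} (P : Matrix (Fin 3) (Fin n) ℝ) (l : Fin 3 → ℝ) (b : ℝ) (p : ℝ × ℝ) :
    chOut P (chPlane l b p) = fun j => chOut P l j + p.1 * (P 0 j - P 1 j)
      + p.2 * (-b * P 0 j + (b - 1) * P 1 j + P 2 j) := by
  ext j
  simp [chOut, chPlane, Fin.sum_univ_three]
  ring

/-- Derivative of the divergences in the coordinates of `chPlane`, in terms of the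
quantities `D2`. -/
lemma hasFDerivAt_chKL_chPlane {n : ℕ} (P : Matrix (Fin 3) (Fin n) ℝ) (l : Fin 3 → ℝ) (b : ℝ)
    (hQ : ∀ j, 0 < chOut P l j) {D2 : Fin 3 → Fin 3 → ℝ}
    (hD2 : ∀ i' i, D2 i' i = -∑ j, P i' j * P i j / chOut P l j) (i : Fin 3) :
    HasFDerivAt (fun p => chKL (P i) (chOut P (chPlane l b p)))
      ((D2 0 i - D2 1 i) • ContinuousLinearMap.fst ℝ ℝ ℝ
        + (-b * D2 0 i + (b - 1) * D2 1 i + D2 2 i) • ContinuousLinearMap.snd ℝ ℝ ℝ) 0 := by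
  simp only [chOut_chPlane]
  refine (hasFDerivAt_chKL_affine (P i) (chOut P l) _ _ hQ).congr_fderiv ?_
  congr 2
  · rw [hD2, hD2, ← sub_eq_zero]
    simp only [← Finset.sum_neg_distrib, ← Finset.sum_sub_distrib]
    exact Finset.sum_eq_zero fun j _ => by ring
  · rw [hD2, hD2, hD2, ← sub_eq_zero]
    simp only [← Finset.sum_neg_distrib, ← Finset.sum_sub_distrib, ← Finset.sum_add_distrib,
      Finset.mul_sum]
    exact Finset.sum_eq_zero fun j _ => by ring

lemma hasFDerivAt_chPlane_zero (l : Fin 3 → ℝ) (b : ℝ) :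
    HasFDerivAt (fun p => chPlane l b p 0)
      (ContinuousLinearMap.fst ℝ ℝ ℝ - b • ContinuousLinearMap.snd ℝ ℝ ℝ) 0 := by
  simpa [chPlane] using (hasFDerivAt_fst.const_add (l 0)).fun_sub (hasFDerivAt_snd.const_mul b)

lemma hasFDerivAt_chPlane_one (l : Fin 3 → ℝ) (b : ℝ) :
    HasFDerivAt (fun p => chPlane l b p 1)
      (-ContinuousLinearMap.fst ℝ ℝ ℝ + (b - 1) • ContinuousLinearMap.snd ℝ ℝ ℝ) 0 := by
  simpa [chPlane] using (hasFDerivAt_fst.const_sub (l 1)).fun_add (hasFDerivAt_snd.const_mul (b - 1))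

lemma hasFDerivAt_chPlane_two (l : Fin 3 → ℝ) (b : ℝ) :
    HasFDerivAt (fun p => chPlane l b p 2) (ContinuousLinearMap.snd ℝ ℝ ℝ) 0 := by
  simpa [chPlane] using hasFDerivAt_snd.const_add (l 2)

/-- Averaging `D2` over an input distribution supported on the first two letters gives `-1`. -/
lemma weighted_sum_D2 {n : ℕ} (P : Matrix (Fin 3) (Fin n) ℝ) (hProw : ∀ i, ∑ j, P i j = 1)
    {l : Fin 3 → ℝ} (hl2 : l 2 = 0) (hQ : ∀ j, 0 < chOut P l j) {D2 : Fin 3 → Fin 3 → ℝ}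
    (hD2 : ∀ i' i, D2 i' i = -∑ j, P i' j * P i j / chOut P l j) (i : Fin 3) :
    l 0 * D2 i 0 + l 1 * D2 i 1 = -1 := by
  rw [hD2, hD2, ← hProw i, mul_neg, mul_neg, ← neg_add, Finset.mul_sum, Finset.mul_sum,
    ← Finset.sum_add_distrib]
  congr 1
  refine Finset.sum_congr rfl fun j _ => ?_
  have hj : chOut P l j = l 0 * P 0 j + l 1 * P 1 j := by
    simp [chOut, Fin.sum_univ_three, hl2]
  have := (hQ j).ne'
  rw [hj] at this ⊢
  field_simp

/-- A capacity-achieving input distribution equalises the divergences on its support. -/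
lemma chKL_eq_of_capacity {n : ℕ} (P : Matrix (Fin 3) (Fin n) ℝ)
    (hProw : ∀ i, ∑ j, P i j = 1) {C : ℝ} (hub : ∀ l ∈ chSimplex 3, chMI P l ≤ C)
    {l : Fin 3 → ℝ} (hls : l ∈ chSimplex 3) (hach : chMI P l = C)
    (h1 : 0 < l 0) (h2 : 0 < l 1) (h3 : l 2 = 0) (hQ : ∀ j, 0 < chOut P l j) :
    chKL (P 0) (chOut P l) = C ∧ chKL (P 1) (chOut P l) = C := by
  obtain ⟨D2, hD2⟩ : ∃ D2 : Fin 3 → Fin 3 → ℝ,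
    ∀ i' i, D2 i' i = -∑ j, P i' j * P i j / chOut P l j := ⟨_, fun _ _ => rfl⟩
  have hsum : l 0 + l 1 = 1 := by simpa [Fin.sum_univ_three, h3] using hls.2
  have hC : l 0 * chKL (P 0) (chOut P l) + l 1 * chKL (P 1) (chOut P l) = C := by
    rw [← hach, chMI_eq_sum_chKL, Fin.sum_univ_three, h3]; ring
  have hMI := (((hasFDerivAt_chPlane_zero l 0).mul (hasFDerivAt_chKL_chPlane P l 0 hQ hD2 0)).add
    ((hasFDerivAt_chPlane_one l 0).mul (hasFDerivAt_chKL_chPlane P l 0 hQ hD2 1))).add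
    ((hasFDerivAt_chPlane_two l 0).mul (hasFDerivAt_chKL_chPlane P l 0 hQ hD2 2))
  have hline := hMI.comp_hasDerivAt_of_eq (0 : ℝ)
    ((hasDerivAt_id (0 : ℝ)).prodMk (hasDerivAt_const (0 : ℝ) (0 : ℝ))) rfl
  have hmax : IsLocalMax (fun t : ℝ => chMI P (chPlane l 0 (t, 0))) 0 := by
    filter_upwards [eventually_gt_nhds (show -l 0 < 0 by linarith),
      eventually_lt_nhds h2] with t ht1 ht2
    change _ ≤ chMI P (chPlane l 0 0)
    rw [chPlane_zero, hach]
    refine hub _ ⟨fun i => ?_, ?_⟩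
    · fin_cases i <;> simp [chPlane, h3] <;> linarith
    · simp [chPlane, Fin.sum_univ_three, h3, hsum]
  have hzero := hmax.hasDerivAt_eq_zero (hline.congr_of_eventuallyEq
    (Eventually.of_forall fun t => by
      simp only [chMI_eq_sum_chKL, Fin.sum_univ_three]; rfl))
  have e0 := weighted_sum_D2 P hProw h3 hQ hD2 0
  have e1 := weighted_sum_D2 P hProw h3 hQ hD2 1
  simp [chPlane_zero, h3] at hzero
  have hd : chKL (P 0) (chOut P l) = chKL (P 1) (chOut P l) := by linarith
  rw [hd, ← add_mul, hsum, one_mul] at hC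
  exact ⟨hd.trans hC, hC⟩

/-- The mutual overlap of two distinct rows in the support is less than one. -/
lemma overlap_lt_one {n : ℕ} (P : Matrix (Fin 3) (Fin n) ℝ) (hProw : ∀ i, ∑ j, P i j = 1)
    (hne : P 0 ≠ P 1) {l : Fin 3 → ℝ} (hsum : l 0 + l 1 = 1)
    (h1 : 0 < l 0) (h2 : 0 < l 1) (hl2 : l 2 = 0) (hQ : ∀ j, 0 < chOut P l j)
    {D2 : Fin 3 → Fin 3 → ℝ}
    (hD2 : ∀ i' i, D2 i' i = -∑ j, P i' j * P i j / chOut P l j) :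
    -D2 0 1 < 1 := by
  have e0 := weighted_sum_D2 P hProw hl2 hQ hD2 0
  have e1 := weighted_sum_D2 P hProw hl2 hQ hD2 1
  have hsymm : D2 1 0 = D2 0 1 := by simp only [hD2, mul_comm]
  obtain ⟨j₀, hj₀⟩ := Function.ne_iff.1 hne
  have hpos : 0 < ∑ j, (P 0 j - P 1 j) ^ 2 / chOut P l j := by
    refine Finset.sum_pos' (fun j _ => div_nonneg (sq_nonneg _) (hQ j).le)
      ⟨j₀, Finset.mem_univ _, div_pos ?_ (hQ j₀)⟩
    have := sub_ne_zero.2 hj₀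
    positivity
  have hexp : ∑ j, (P 0 j - P 1 j) ^ 2 / chOut P l j = -D2 0 0 + 2 * D2 0 1 - D2 1 1 := by
    simp only [hD2, mul_neg, neg_neg, sub_neg_eq_add, ← sub_eq_add_neg, Finset.mul_sum,
      ← Finset.sum_sub_distrib, ← Finset.sum_add_distrib]
    exact Finset.sum_congr rfl fun j _ => by ring
  rw [hexp] at hpos
  rw [hsymm] at e1
  have hl1 : l 1 = 1 - l 0 := by linarith
  have key : l 0 * l 1 * (-D2 0 0 + 2 * D2 0 1 - D2 1 1) = 1 + D2 0 1 := by
    rw [hl1] at e0 e1 ⊢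
    linear_combination (-(1 - l 0)) * e0 - l 0 * e1
  have := mul_pos (mul_pos h1 h2) hpos
  linarith

/-- Derivative of the reweighting factors of the Arimoto map at a point where all divergences
agree. -/
lemma hasFDerivAt_chWeight {n : ℕ} (P : Matrix (Fin 3) (Fin n) ℝ) (hProw : ∀ i, ∑ j, P i j = 1)
    {C : ℝ} {l : Fin 3 → ℝ} (hsum : l 0 + l 1 = 1) (hl2 : l 2 = 0) (b : ℝ)
    (hQ : ∀ j, 0 < chOut P l j) (hC : ∀ i, chKL (P i) (chOut P l) = C)
    {D2 : Fin 3 → Fin 3 → ℝ}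
    (hD2 : ∀ i' i, D2 i' i = -∑ j, P i' j * P i j / chOut P l j) (i : Fin 3) :
    HasFDerivAt (fun p => Real.exp (chKL (P i) (chOut P (chPlane l b p)))
        / ∑ k, chPlane l b p k * Real.exp (chKL (P k) (chOut P (chPlane l b p))))
      ((D2 0 i - D2 1 i) • ContinuousLinearMap.fst ℝ ℝ ℝ
        + (-b * D2 0 i + (b - 1) * D2 1 i + D2 2 i) • ContinuousLinearMap.snd ℝ ℝ ℝ) 0 := by
  have hE := fun i => (hasFDerivAt_chKL_chPlane P l b hQ hD2 i).exp
  have hZ := (((hasFDerivAt_chPlane_zero l b).fun_mul (hE 0)).fun_add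
    ((hasFDerivAt_chPlane_one l b).fun_mul (hE 1))).fun_add
    ((hasFDerivAt_chPlane_two l b).fun_mul (hE 2))
  simp only [Fin.sum_univ_three]
  have hZ0 : chPlane l b 0 0 * Real.exp (chKL (P 0) (chOut P (chPlane l b 0)))
      + chPlane l b 0 1 * Real.exp (chKL (P 1) (chOut P (chPlane l b 0)))
      + chPlane l b 0 2 * Real.exp (chKL (P 2) (chOut P (chPlane l b 0))) = Real.exp C := by
    simp only [chPlane_zero, hC, hl2, ← add_mul, hsum]
    ring
  have e0 := weighted_sum_D2 P hProw hl2 hQ hD2 0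
  have e1 := weighted_sum_D2 P hProw hl2 hQ hD2 1
  have e2 := weighted_sum_D2 P hProw hl2 hQ hD2 2
  have hinv := (hasDerivAt_inv (hZ0.trans_ne (Real.exp_pos C).ne')).comp_hasFDerivAt 0 hZ
  simp only [div_eq_mul_inv]
  refine ((hE i).fun_mul hinv).congr_fderiv ?_
  simp only [Function.comp_apply, hZ0]
  simp only [chPlane_zero, hC, hl2]
  have hexp := (Real.exp_pos C).ne'
  ext
  · simp
    field_simp
    linear_combination (-1 : ℝ) * e0 + e1
  · simp
    field_simp
    linear_combination b * e0 + (1 - b) * e1 - e2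

/-- Derivative of the Arimoto map in the coordinates of `chPlane`: the first coordinate is
adapted to the contracting direction. -/
lemma hasFDerivAt_chAF_chPlane {n : ℕ} (P : Matrix (Fin 3) (Fin n) ℝ)
    (hProw : ∀ i, ∑ j, P i j = 1) {C : ℝ} {l : Fin 3 → ℝ} (hsum : l 0 + l 1 = 1)
    (hl2 : l 2 = 0) {b : ℝ} (hQ : ∀ j, 0 < chOut P l j)
    (hC : ∀ i, chKL (P i) (chOut P l) = C) {D2 : Fin 3 → Fin 3 → ℝ}
    (hD2 : ∀ i' i, D2 i' i = -∑ j, P i' j * P i j / chOut P l j)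
    (hb : b * (1 + D2 0 1) = l 0 * (D2 0 1 - D2 0 2)) :
    HasFDerivAt (fun p => chAF P (chPlane l b p) 0 - l 0 + b * chAF P (chPlane l b p) 2)
      ((-D2 0 1) • ContinuousLinearMap.fst ℝ ℝ ℝ) 0 := by
  have hw := hasFDerivAt_chWeight P hProw hsum hl2 b hQ hC hD2
  have e0 := weighted_sum_D2 P hProw hl2 hQ hD2 0
  have hsymm : ∀ i k, D2 i k = D2 k i := fun i k => by simp only [hD2, mul_comm]
  have h := (((hasFDerivAt_chPlane_zero l b).fun_mul (hw 0)).sub_const (l 0)).fun_add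
    (((hasFDerivAt_chPlane_two l b).fun_mul (hw 2)).const_mul b)
  simp only [chAF, mul_div_assoc]
  refine h.congr_fderiv ?_
  have hden : Real.exp C / (∑ k, l k * Real.exp C) = 1 := by
    rw [← Finset.sum_mul, Fin.sum_univ_three, hl2, hsum]
    field_simp
    simp
  simp only [chPlane_zero, hC, hl2, hden]
  ext
  · simp
    rw [hsymm 1 0]
    linear_combination e0 - D2 0 1 * hsum
  · simp
    rw [hsymm 1 0, hsymm 2 0]
    rw [← mul_eq_zero]
    linear_combination (-b) * e0 + hb + b * D2 0 1 * hsum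

lemma chPlane_of_sum_eq_one {l x : Fin 3 → ℝ} (b : ℝ) (hl2 : l 2 = 0) (hsum : l 0 + l 1 = 1)
    (hx : ∑ i, x i = 1) : chPlane l b (x 0 - l 0 + b * x 2, x 2) = x := by
  rw [Fin.sum_univ_three] at hx
  ext i
  fin_cases i
  · simp [chPlane]; ring
  · simp [chPlane]; linear_combination hsum - hx
  · simp [chPlane, hl2]

end

/-- **Theorem 7.** For `m = 3`, if the capacity-achieving distribution has
`λ*_1, λ*_2 > 0`, `λ*_3 = 0` and `D(P³‖Q*) = C`, and `ρ > 0`, then the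
Arimoto iterates started sufficiently close to `λ*` in the interior of the
simplex converge at order `1/N`, with
`N μ^N_1 → −b_1/ρ`, `N μ^N_2 → −b_2/ρ`, `N μ^N_3 → 1/ρ`. -/
theorem stmt_17 (n : ℕ) (P : Matrix (Fin 3) (Fin n) ℝ)
    (hPnn : ∀ i j, 0 ≤ P i j) (hProw : ∀ i, ∑ j, P i j = 1)
    (hPcol : ∀ j, ∃ i, 0 < P i j) (hrank : P.rank = 3)
    (C : ℝ) (hub : ∀ l ∈ chSimplex 3, chMI P l ≤ C)
    (lstar : Fin 3 → ℝ) (hls : lstar ∈ chSimplex 3) (hach : chMI P lstar = C)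
    (h1 : 0 < lstar 0) (h2 : 0 < lstar 1) (h3 : lstar 2 = 0)
    (hQpos : ∀ j, 0 < chOut P lstar j)
    (hD3C : chKL (P 2) (chOut P lstar) = C)
    (D2 : Fin 3 → Fin 3 → ℝ)
    (hD2 : ∀ i' i, D2 i' i = -∑ j, P i' j * P i j / chOut P lstar j)
    (b1 b2 ρ : ℝ)
    (hb1 : b1 = lstar 0 * (D2 0 1 - D2 0 2) / (1 + D2 0 1))
    (hb2 : b2 = lstar 1 * (D2 0 1 - D2 1 2) / (1 + D2 0 1))
    (hρ : ρ = lstar 0 * (D2 0 2 * (D2 0 1 - D2 0 2)) / (1 + D2 0 1)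
            + lstar 1 * (D2 1 2 * (D2 0 1 - D2 1 2)) / (1 + D2 0 1)
            - D2 2 2)
    (hρpos : 0 < ρ) :
    ∃ δ > (0 : ℝ), ∀ lam : ℕ → Fin 3 → ℝ,
      (∀ i, 0 < lam 0 i) → (∑ i, lam 0 i = 1) →
      Real.sqrt (∑ i, (lam 0 i - lstar i) ^ 2) < δ →
      (∀ N, lam (N + 1) = chAF P (lam N)) →
      Filter.Tendsto (fun N : ℕ => (N : ℝ) * (lam N 0 - lstar 0))
          Filter.atTop (nhds (-(b1 / ρ))) ∧
        Filter.Tendsto (fun N : ℕ => (N : ℝ) * (lam N 1 - lstar 1))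
          Filter.atTop (nhds (-(b2 / ρ))) ∧
        Filter.Tendsto (fun N : ℕ => (N : ℝ) * (lam N 2 - lstar 2))
          Filter.atTop (nhds (1 / ρ)) := by
  have hsum : lstar 0 + lstar 1 = 1 := by simpa [Fin.sum_univ_three, h3] using hls.2
  obtain ⟨hC0, hC1⟩ := chKL_eq_of_capacity P hProw hub hls hach h1 h2 h3 hQpos
  have hC : ∀ i, chKL (P i) (chOut P lstar) = C := by
    intro i; fin_cases i <;> assumption
  have hne : P 0 ≠ P 1 := (Matrix.row_injective_of_rank_eq P hrank).ne (by decide)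
  have ha1 := overlap_lt_one P hProw hne hsum h1 h2 h3 hQpos hD2
  have ha0 : 0 ≤ -D2 0 1 := by
    rw [hD2, neg_neg]
    exact Finset.sum_nonneg fun j _ =>
      div_nonneg (mul_nonneg (hPnn 0 j) (hPnn 1 j)) (hQpos j).le
  have hden : (1 + D2 0 1) ≠ 0 := by linarith
  have e2 := weighted_sum_D2 P hProw h3 hQpos hD2 2
  have hsymm : ∀ i k, D2 i k = D2 k i := fun i k => by simp only [hD2, mul_comm]
  have hbb : b1 + b2 = 1 := by
    rw [hb1, hb2, ← add_div, div_eq_one_iff_eq hden]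
    rw [hsymm 2 0, hsymm 2 1] at e2
    linear_combination D2 0 1 * hsum - e2
  have hρb : ρ = b1 * D2 0 2 + b2 * D2 1 2 - D2 2 2 := by
    rw [hρ, hb1, hb2]; ring
  set f : ℝ × ℝ → ℝ := fun p =>
    chAF P (chPlane lstar b1 p) 0 - lstar 0 + b1 * chAF P (chPlane lstar b1 p) 2 with hf_def
  set g : ℝ × ℝ → ℝ := fun p => Real.exp (chKL (P 2) (chOut P (chPlane lstar b1 p)))
    / ∑ k, chPlane lstar b1 p k * Real.exp (chKL (P k) (chOut P (chPlane lstar b1 p))) with hg_def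
  have hf : HasFDerivAt f ((-D2 0 1) • ContinuousLinearMap.fst ℝ ℝ ℝ) 0 :=
    hasFDerivAt_chAF_chPlane P hProw hsum h3 hQpos hC hD2 (by rw [hb1, div_mul_cancel₀ _ hden])
  have hg : HasFDerivAt g ((D2 0 2 - D2 1 2) • ContinuousLinearMap.fst ℝ ℝ ℝ
      - ρ • ContinuousLinearMap.snd ℝ ℝ ℝ) 0 := by
    refine (hasFDerivAt_chWeight P hProw hsum h3 b1 hQpos hC hD2 2).congr_fderiv ?_
    have hcoef : -b1 * D2 0 2 + (b1 - 1) * D2 1 2 + D2 2 2 = -ρ := by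
      linear_combination D2 1 2 * hbb + hρb
    rw [hcoef]
    ext <;> simp
  have hZ0 : ∑ k, lstar k * Real.exp C = Real.exp C := by
    rw [← Finset.sum_mul, Fin.sum_univ_three, h3, hsum]
    ring
  have hexp := (Real.exp_pos C).ne'
  have hf0 : f 0 = 0 := by
    simp only [hf_def, chAF, chPlane_zero, hC, hZ0, h3, mul_div_assoc, div_self hexp]
    ring
  have hg0 : g 0 = 1 := by
    simp only [hg_def, chPlane_zero, hC, hZ0, div_self hexp]
  obtain ⟨δ, hδ, hconv⟩ := tendsto_zero_of_semihyperbolic ha0 ha1 hρpos hf0 hg0 hf hg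
  refine ⟨δ / (1 + |b1|), by positivity, fun lam hpos0 hsum0 hdist hrec => ?_⟩
  have hlam : ∀ N, (∀ i, 0 < lam N i) ∧ ∑ i, lam N i = 1 := by
    intro N
    induction N with
    | zero => exact ⟨hpos0, hsum0⟩
    | succ N ih => rw [hrec N]; exact ⟨chAF_pos P ih.1, sum_chAF P ih.1⟩
  have hcoord : ∀ N, chPlane lstar b1 (lam N 0 - lstar 0 + b1 * lam N 2, lam N 2) = lam N :=
    fun N => chPlane_of_sum_eq_one b1 h3 hsum (hlam N).2
  have hz : ∀ N, 0 < lam N 2 := fun N => (hlam N).1 2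
  have hustep : ∀ N, lam (N + 1) 0 - lstar 0 + b1 * lam (N + 1) 2
      = f (lam N 0 - lstar 0 + b1 * lam N 2, lam N 2) := by
    intro N
    simp only [hf_def, hcoord, hrec]
  have hzstep : ∀ N, lam (N + 1) 2
      = lam N 2 * g (lam N 0 - lstar 0 + b1 * lam N 2, lam N 2) := by
    intro N
    simp only [hg_def, hcoord, hrec N, chAF, mul_div_assoc]
  have hclose : ∀ i, |lam 0 i - lstar i| < δ / (1 + |b1|) := fun i =>
    (Real.abs_le_sqrt (Finset.single_le_sum (f := fun i => (lam 0 i - lstar i) ^ 2)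
      (fun _ _ => sq_nonneg _) (Finset.mem_univ i))).trans_lt hdist
  have hc0 := hclose 0
  have hc2 := hclose 2
  rw [h3, sub_zero, abs_of_pos (hz 0)] at hc2
  have hmul : δ / (1 + |b1|) + |b1| * (δ / (1 + |b1|)) = δ := by field_simp
  have hu0 : |lam 0 0 - lstar 0 + b1 * lam 0 2| < δ := by
    refine (abs_add_le _ _).trans_lt ?_
    rw [abs_mul, abs_of_pos (hz 0)]
    have := mul_le_mul_of_nonneg_left hc2.le (abs_nonneg b1)
    linarith
  have hz0 : lam 0 2 < δ := hc2.trans_le (div_le_self hδ.le (by linarith [abs_nonneg b1]))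
  obtain ⟨hu_lim, hz_lim⟩ := hconv _ _ hz hu0 hz0 hustep hzstep
  obtain ⟨hNu, hNz⟩ := tendsto_rate_of_semihyperbolic ha0 ha1 hρpos hf0 hg0 hf hg hz hustep hzstep
    hu_lim hz_lim
  refine ⟨?_, ?_, ?_⟩
  · have h := hNu.sub (hNz.const_mul b1)
    rw [show (0 : ℝ) - b1 * (1 / ρ) = -(b1 / ρ) by ring] at h
    refine h.congr fun N => ?_
    ring
  · have h := hNu.neg.sub (hNz.const_mul b2)
    rw [show -(0 : ℝ) - b2 * (1 / ρ) = -(b2 / ρ) by ring] at h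
    refine h.congr fun N => ?_
    have hN := (hlam N).2
    rw [Fin.sum_univ_three] at hN
    linear_combination (-(N : ℝ)) * (lam N 2 * hbb + hN - hsum)
  · simpa [h3] using hNz
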